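/- Let m < M be real numbers and let A ∈ B(H) be self-adjoint with Λ(A) ⊆ [m, M]. Let f be a continuous real function on [m, M] and let p_L, p_U be real polynomials with 0 < p_L(x) ≤ f(x) ≤ p_U(x) for all x ∈ [m, M]. Put μ_U = min Λ(p_U(A)), ν_U = max Λ(p_U(A)), μ_L = min Λ(p_L(A)), ν_L = max Λ(p_L(A)), and assume μ_U < ν_U and μ_L < ν_L. Then Φ(f(A)) ≤ V*( Σ_{i : a_i ≥ 0} a_i · K(μ_U, ν_U, i) · p_U(A)^i + Σ_{i : a_i < 0} a_i · K(μ_L, ν_L, i)^{−1} · p_L(A)^i ) V in the Loewner order. -/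

import Mathlib

open ContinuousLinearMap in
/-- The Kantorovich constant `K(m', M', r)`, with the convention that it equals `1`
for `r = 0` and `r = 1`. -/
noncomputable def kantorovich (m M r : ℝ) : ℝ :=
  if r = 0 ∨ r = 1 then 1 else
    ((m * M ^ r - M * m ^ r) / ((r - 1) * (M - m))) *
      (((r - 1) * (M ^ r - m ^ r)) / (r * (m * M ^ r - M * m ^ r))) ^ r

open ContinuousLinearMap Polynomial

/-- The Kantorovich constant of a natural exponent is at least `1`. -/
theorem one_le_kantorovich_natCast {m M : ℝ} (hm : 0 < m) (hmM : m < M) (n : ℕ) :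
    1 ≤ kantorovich m M n := by
  unfold kantorovich
  split_ifs with h
  · exact le_rfl
  · push Not at h
    have hn0 : n ≠ 0 := by exact_mod_cast h.1
    have hn1 : n ≠ 1 := by exact_mod_cast h.2
    obtain ⟨k, rfl⟩ : ∃ k, n = k + 1 := Nat.exists_eq_succ_of_ne_zero hn0
    have hk : k ≠ 0 := by omega
    simp only [Real.rpow_natCast]
    have hkpos : (0 : ℝ) < k := by exact_mod_cast Nat.pos_of_ne_zero hk
    have hcast : ((k + 1 : ℕ) : ℝ) - 1 = k := by push_cast; ring
    rw [hcast]
    have hM : 0 < M := hm.trans hmM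
    have hd : 0 < M - m := sub_pos.2 hmM
    have hc : 0 < m * M ^ (k + 1) - M * m ^ (k + 1) := by
      have hlt : m ^ k < M ^ k := pow_lt_pow_left₀ hmM hm.le hk
      have := mul_pos (mul_pos hm hM) (sub_pos.2 hlt)
      calc (0 : ℝ) < m * M * (M ^ k - m ^ k) := this
        _ = _ := by ring
    have hα : 0 < M ^ (k + 1) - m ^ (k + 1) :=
      sub_pos.2 (pow_lt_pow_left₀ hmM hm.le hn0)
    set c := m * M ^ (k + 1) - M * m ^ (k + 1) with hc_def
    set α := M ^ (k + 1) - m ^ (k + 1) with hα_def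
    have hr : (0 : ℝ) < ((k + 1 : ℕ) : ℝ) := by positivity
    set s := k * α / (((k + 1 : ℕ) : ℝ) * c) with hs
    have hs_pos : 0 < s := by positivity
    have bern : 1 + ((k + 1 : ℕ) : ℝ) * (s * m - 1) ≤ (s * m) ^ (k + 1) := by
      have := one_add_mul_le_pow (a := s * m - 1) (by nlinarith [mul_pos hs_pos hm]) (k + 1)
      simpa using this
    have hmk : 0 < m ^ (k + 1) := by positivity
    have hlhs : c / (k * (M - m)) * (1 + ((k + 1 : ℕ) : ℝ) * (s * m - 1)) = m ^ (k + 1) := by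
      have hsm : ((k + 1 : ℕ) : ℝ) * s = k * α / c := by
        rw [hs]; field_simp
      have hchord : α * m - c = m ^ (k + 1) * (M - m) := by
        rw [hα_def, hc_def]; ring
      calc c / (k * (M - m)) * (1 + ((k + 1 : ℕ) : ℝ) * (s * m - 1))
          = c / (k * (M - m)) * (((k + 1 : ℕ) : ℝ) * s * m - (((k + 1 : ℕ) : ℝ) - 1)) := by ring
        _ = (α * m - c) / (M - m) := by rw [hsm, hcast]; field_simp
        _ = m ^ (k + 1) := by rw [hchord]; field_simp
    have key : m ^ (k + 1) ≤ c / (k * (M - m)) * s ^ (k + 1) * m ^ (k + 1) := by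
      calc m ^ (k + 1) = c / (k * (M - m)) * (1 + ((k + 1 : ℕ) : ℝ) * (s * m - 1)) := hlhs.symm
        _ ≤ c / (k * (M - m)) * (s * m) ^ (k + 1) := by gcongr
        _ = _ := by rw [mul_pow]; ring
    exact le_of_mul_le_mul_right (by simpa using key) hmk

/-- If the extreme points of the spectrum of `cfc g A` differ and `g` is positive on the spectrum
of `A`, then the smallest point of the spectrum of `cfc g A` is positive. -/
theorem sInf_spectrum_cfc_pos {H : Type*} [NormedAddCommGroup H] [InnerProductSpace ℂ H]
    [CompleteSpace H] {A : H →L[ℂ] H} (hA : IsSelfAdjoint A) {g : ℝ → ℝ}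
    (hg : ContinuousOn g (spectrum ℝ A)) (hpos : ∀ x ∈ spectrum ℝ A, 0 < g x)
    (hlt : sInf (spectrum ℝ (cfc g A)) < sSup (spectrum ℝ (cfc g A))) :
    0 < sInf (spectrum ℝ (cfc g A)) := by
  have hne : (spectrum ℝ (cfc g A)).Nonempty := by
    by_contra h
    rw [Set.not_nonempty_iff_eq_empty] at h
    simp [h] at hlt
  have hmem := (spectrum.isCompact (𝕜 := ℝ) (cfc g A)).sInf_mem hne
  rw [cfc_map_spectrum g A hA hg] at hmem ⊢
  obtain ⟨x, hx, hgx⟩ := hmem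
  exact hgx ▸ hpos x hx

/-- Compression by a bounded operator is monotone for the Loewner order. -/
theorem adjoint_conj_mono {H K : Type*} [NormedAddCommGroup H] [InnerProductSpace ℂ H]
    [CompleteSpace H] [NormedAddCommGroup K] [InnerProductSpace ℂ K] [CompleteSpace K]
    (V : K →L[ℂ] H) {X Y : H →L[ℂ] H} (h : X ≤ Y) :
    (adjoint V) ∘L X ∘L V ≤ (adjoint V) ∘L Y ∘L V := by
  rw [ContinuousLinearMap.le_def] at h ⊢
  simpa [ContinuousLinearMap.sub_comp, ContinuousLinearMap.comp_sub] using h.adjoint_conj V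

/-- A scalar inequality `b * g ^ n ≤ c * h ^ n` on the spectrum lifts to the functional calculus. -/
theorem smul_cfc_pow_le_smul_cfc_pow {H : Type*} [NormedAddCommGroup H] [InnerProductSpace ℂ H]
    [CompleteSpace H] {A : H →L[ℂ] H} (hA : IsSelfAdjoint A) {g h : ℝ → ℝ}
    (hg : ContinuousOn g (spectrum ℝ A)) (hh : ContinuousOn h (spectrum ℝ A)) {b c : ℝ} {n : ℕ}
    (hle : ∀ x ∈ spectrum ℝ A, b * g x ^ n ≤ c * h x ^ n) :
    b • cfc g A ^ n ≤ c • cfc h A ^ n := by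
  rw [← cfc_pow g n A hg hA, ← cfc_pow h n A hh hA,
    ← cfc_const_mul b (fun x => g x ^ n) A (hg.pow n),
    ← cfc_const_mul c (fun x => h x ^ n) A (hh.pow n)]
  exact cfc_mono hle (continuousOn_const.mul (hg.pow n)) (continuousOn_const.mul (hh.pow n))

theorem stmt0
    {H K : Type*} [NormedAddCommGroup H] [InnerProductSpace ℂ H] [CompleteSpace H]
    [NormedAddCommGroup K] [InnerProductSpace ℂ K] [CompleteSpace K]
    (V : K →L[ℂ] H) (hV : (adjoint V) ∘L V = 1)
    (I : ℕ) (a : ℕ → ℝ)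
    (m M : ℝ) (hmM : m < M)
    (A : H →L[ℂ] H) (hA : IsSelfAdjoint A) (hspec : spectrum ℝ A ⊆ Set.Icc m M)
    (f : ℝ → ℝ) (hf : ContinuousOn f (Set.Icc m M))
    (pL pU : Polynomial ℝ)
    (hp : ∀ x ∈ Set.Icc m M, 0 < pL.eval x ∧ pL.eval x ≤ f x ∧ f x ≤ pU.eval x)
    (μU νU μL νL : ℝ)
    (hμU : μU = sInf (spectrum ℝ (cfc (fun x => pU.eval x) A)))
    (hνU : νU = sSup (spectrum ℝ (cfc (fun x => pU.eval x) A)))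
    (hμL : μL = sInf (spectrum ℝ (cfc (fun x => pL.eval x) A)))
    (hνL : νL = sSup (spectrum ℝ (cfc (fun x => pL.eval x) A)))
    (hU : μU < νU) (hL : μL < νL) :
    (adjoint V) ∘L (∑ i ∈ Finset.range (I + 1), a i • (cfc f A) ^ i) ∘L V ≤
    (adjoint V) ∘L
      ((∑ i ∈ (Finset.range (I + 1)).filter (fun i => 0 ≤ a i),
          (a i * kantorovich μU νU (i : ℝ)) • (cfc (fun x => pU.eval x) A) ^ i) +
        ∑ i ∈ (Finset.range (I + 1)).filter (fun i => a i < 0),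
          (a i * (kantorovich μL νL (i : ℝ))⁻¹) • (cfc (fun x => pL.eval x) A) ^ i) ∘L V := by
  have hpUc : ContinuousOn (fun x => pU.eval x) (spectrum ℝ A) := pU.continuous.continuousOn
  have hpLc : ContinuousOn (fun x => pL.eval x) (spectrum ℝ A) := pL.continuous.continuousOn
  have hfc : ContinuousOn f (spectrum ℝ A) := hf.mono hspec
  have hμU_pos : 0 < μU := by
    rw [hμU]
    refine sInf_spectrum_cfc_pos hA hpUc (fun x hx => ?_) (by rwa [← hμU, ← hνU])
    obtain ⟨h₀, h₁, h₂⟩ := hp x (hspec hx)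
    exact h₀.trans_le (h₁.trans h₂)
  have hμL_pos : 0 < μL := by
    rw [hμL]
    exact sInf_spectrum_cfc_pos hA hpLc (fun x hx => (hp x (hspec hx)).1)
      (by rwa [← hμL, ← hνL])
  apply adjoint_conj_mono
  rw [← Finset.sum_filter_add_sum_filter_not (Finset.range (I + 1)) (fun i => 0 ≤ a i)]
  simp only [not_le]
  refine add_le_add (Finset.sum_le_sum fun i hi => ?_) (Finset.sum_le_sum fun i hi => ?_)
  · have hai := (Finset.mem_filter.1 hi).2
    refine smul_cfc_pow_le_smul_cfc_pow hA hfc hpUc fun x hx => ?_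
    obtain ⟨h₀, h₁, h₂⟩ := hp x (hspec hx)
    have hf_pos : 0 < f x := h₀.trans_le h₁
    have hK := one_le_kantorovich_natCast hμU_pos hU i
    calc a i * f x ^ i ≤ a i * pU.eval x ^ i := by gcongr
      _ ≤ a i * kantorovich μU νU i * pU.eval x ^ i := by
        have := hf_pos.trans_le h₂
        gcongr
        exact le_mul_of_one_le_right hai hK
  · have hai := (Finset.mem_filter.1 hi).2
    refine smul_cfc_pow_le_smul_cfc_pow hA hfc hpLc fun x hx => ?_
    obtain ⟨h₀, h₁, -⟩ := hp x (hspec hx)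
    have hK := inv_le_one_of_one_le₀ (one_le_kantorovich_natCast hμL_pos hL i)
    calc a i * f x ^ i ≤ a i * pL.eval x ^ i :=
          mul_le_mul_of_nonpos_left (pow_le_pow_left₀ h₀.le h₁ i) hai.le
      _ ≤ a i * (kantorovich μL νL i)⁻¹ * pL.eval x ^ i := by
        gcongr
        simpa using mul_le_mul_of_nonpos_left hK hai.le
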